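/- Let α ∈ ℝ \ {0} and let m ∈ ℤ satisfy q^m < |α|. Then the sequence v_m = {v_{m,j}}_{j∈ℤ} is not identically zero, it is square summable, i.e. ∑_{j∈ℤ} |v_{m,j}|² < ∞, and it satisfies the eigenvalue equation v_{m,j−1} + α q^{−j} v_{m,j} + v_{m,j+1} = (α^{−1} q^{m} + α q^{−m}) v_{m,j} for all j ∈ ℤ. -/

import Mathlib

open Complex Filter Topology

/-- Finite q-Pochhammer symbol `(a;q)_n`. -/
noncomputable def qp (q a : ℂ) (n : ℕ) : ℂ := ∏ k ∈ Finset.range n, (1 - a * q ^ k)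

/-- Infinite q-Pochhammer symbol `(a;q)_∞`. -/
noncomputable def qpInf (q a : ℂ) : ℂ := ∏' k : ℕ, (1 - a * q ^ k)

/-- Regularized confluent basic hypergeometric series `₁φ̃₁(0;b;q,w)`. -/
noncomputable def phiT (q b w : ℂ) : ℂ :=
  ∑' k : ℕ, qpInf q (b * q ^ k) * (-1) ^ k * q ^ (k * (k - 1) / 2) * w ^ k / qp q q k

/-- The eigenvector components `v_{m,j}`. -/
noncomputable def vmj (q α : ℝ) (m j : ℤ) : ℂ :=
  (-1) ^ j * (α : ℂ) ^ (-j) * (q : ℂ) ^ (j * (j + 1) / 2) *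
    phiT (q : ℂ) ((q : ℂ) ^ (j - m + 1)) ((α : ℂ) ^ (-2 : ℤ) * (q : ℂ) ^ (m + j + 1))

/-- The coefficient of `w ^ k` in `phiT q b w`, without its factor `qpInf q (b * q ^ k)`. -/
noncomputable def phiCoeff (q : ℂ) (k : ℕ) : ℂ := (-1) ^ k * q ^ (k * (k - 1) / 2) / qp q q k

theorem phiT_eq_tsum (q b w : ℂ) :
    phiT q b w = ∑' k : ℕ, qpInf q (b * q ^ k) * (phiCoeff q k * w ^ k) := by
  unfold phiT phiCoeff
  congr 1
  ext k
  ring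

theorem qp_succ (q a : ℂ) (n : ℕ) : qp q a (n + 1) = qp q a n * (1 - a * q ^ n) :=
  Finset.prod_range_succ _ _

theorem one_sub_pow_succ_ne_zero {q : ℂ} (hq : ‖q‖ < 1) (k : ℕ) : 1 - q ^ (k + 1) ≠ 0 := by
  intro h
  have h1 : ‖q ^ (k + 1)‖ < 1 := by
    rw [norm_pow]
    exact pow_lt_one₀ (norm_nonneg _) hq (Nat.succ_ne_zero k)
  rw [← sub_eq_zero.mp h] at h1
  simp at h1

theorem qp_self_ne_zero {q : ℂ} (hq : ‖q‖ < 1) (n : ℕ) : qp q q n ≠ 0 := by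
  refine Finset.prod_ne_zero_iff.mpr fun k _ => ?_
  rw [← pow_succ']
  exact one_sub_pow_succ_ne_zero hq k

theorem summable_norm_neg_mul_pow {q : ℂ} (hq : ‖q‖ < 1) (a : ℂ) :
    Summable fun k : ℕ => ‖-(a * q ^ k)‖ := by
  simp only [norm_neg, norm_mul, norm_pow]
  exact (summable_geometric_of_lt_one (norm_nonneg _) hq).mul_left _

theorem multipliable_one_sub_mul_pow {q : ℂ} (hq : ‖q‖ < 1) (a : ℂ) :
    Multipliable fun k : ℕ => 1 - a * q ^ k := by
  simpa [sub_eq_add_neg] using multipliable_one_add_of_summable (summable_norm_neg_mul_pow hq a)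

theorem qpInf_eq_mul {q : ℂ} (hq : ‖q‖ < 1) (a : ℂ) :
    qpInf q a = (1 - a) * qpInf q (a * q) := by
  unfold qpInf
  have h := multipliable_one_sub_mul_pow hq (a * q)
  have e : ∀ k : ℕ, 1 - a * q * q ^ k = 1 - a * q ^ (k + 1) := fun k => by ring
  simp only [e] at h ⊢
  rw [tprod_eq_zero_mul' (f := fun k : ℕ => 1 - a * q ^ k) h]
  simp

theorem qpInf_self_ne_zero {q : ℂ} (hq : ‖q‖ < 1) : qpInf q q ≠ 0 := by
  have h := tprod_one_add_ne_zero_of_summable (f := fun k : ℕ => -(q * q ^ k)) (fun k => by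
    rw [← sub_eq_add_neg, ← pow_succ']
    exact one_sub_pow_succ_ne_zero hq k) (summable_norm_neg_mul_pow hq q)
  simpa [qpInf, sub_eq_add_neg] using h

theorem qpInf_pow_succ_mul_qp {q : ℂ} (hq : ‖q‖ < 1) (n : ℕ) :
    qpInf q (q ^ (n + 1)) * qp q q n = qpInf q q := by
  induction n with
  | zero => simp [qp]
  | succ n ih =>
    rw [← ih, qpInf_eq_mul hq (q ^ (n + 1)), qp_succ, ← pow_succ, ← pow_succ']
    ring

theorem qpInf_zpow_of_nonpos {q : ℂ} (hq : q ≠ 0) {i : ℤ} (hi : i ≤ 0) :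
    qpInf q (q ^ i) = 0 := by
  refine tprod_of_exists_eq_zero ⟨i.natAbs, ?_⟩
  rw [← zpow_natCast, ← zpow_add₀ hq, show i + (i.natAbs : ℤ) = 0 by omega]
  simp

theorem norm_qpInf_zpow_le_one {q : ℝ} (hq0 : 0 < q) (hq1 : q < 1) (i : ℤ) :
    ‖qpInf (q : ℂ) ((q : ℂ) ^ i)‖ ≤ 1 := by
  have hq : ‖(q : ℂ)‖ < 1 := by simpa [abs_of_pos hq0] using hq1
  have hqc : (q : ℂ) ≠ 0 := by exact_mod_cast hq0.ne'
  rcases le_or_gt i 0 with hi | hi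
  · simp [qpInf_zpow_of_nonpos hqc hi]
  lift i to ℕ using hi.le
  have h := (multipliable_one_sub_mul_pow hq ((q : ℂ) ^ (i : ℤ))).hasProd
  refine le_of_tendsto h.norm (Eventually.of_forall fun s => ?_)
  refine Finset.prod_le_one (fun _ _ => norm_nonneg _) fun k _ => ?_
  have e : (1 - (q : ℂ) ^ (i : ℤ) * (q : ℂ) ^ k) = ((1 - q ^ (i + k) : ℝ) : ℂ) := by
    push_cast
    rw [zpow_natCast, pow_add]
  rw [e, Complex.norm_real, Real.norm_eq_abs, abs_le]
  have h0 : 0 < q ^ (i + k) := by positivity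
  have h1 : q ^ (i + k) ≤ 1 := pow_le_one₀ hq0.le hq1.le
  constructor <;> linarith

theorem phiCoeff_succ {q : ℂ} (hq : ‖q‖ < 1) (k : ℕ) :
    phiCoeff q (k + 1) * (1 - q ^ (k + 1)) = -q ^ k * phiCoeff q k := by
  have h1 := one_sub_pow_succ_ne_zero hq k
  have h2 := qp_self_ne_zero hq k
  unfold phiCoeff
  rw [Nat.triangle_succ, qp_succ, ← pow_succ']
  field_simp
  ring

theorem phiCoeff_ne_zero {q : ℂ} (hq0 : q ≠ 0) (hq : ‖q‖ < 1) (k : ℕ) : phiCoeff q k ≠ 0 :=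
  div_ne_zero (mul_ne_zero (pow_ne_zero _ (by norm_num)) (pow_ne_zero _ hq0))
    (qp_self_ne_zero hq k)

theorem summable_norm_phiCoeff_mul_pow {q : ℂ} (hq0 : q ≠ 0) (hq : ‖q‖ < 1) (w : ℂ) :
    Summable fun k : ℕ => ‖phiCoeff q k * w ^ k‖ := by
  rcases eq_or_ne w 0 with rfl | hw
  · refine summable_of_ne_finset_zero (s := {0}) fun k hk => ?_
    simp_all
  have hne : ∀ k, phiCoeff q k * w ^ k ≠ 0 := fun k =>
    mul_ne_zero (phiCoeff_ne_zero hq0 hq k) (pow_ne_zero _ hw)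
  refine summable_of_ratio_test_tendsto_lt_one zero_lt_one
    (Eventually.of_forall fun k => norm_ne_zero_iff.mpr (hne k)) ?_
  have hlim : Tendsto (fun k : ℕ => ‖-q ^ k * w / (1 - q ^ (k + 1))‖) atTop (𝓝 0) := by
    have hp := tendsto_pow_atTop_nhds_zero_of_norm_lt_one hq
    have hp1 := (tendsto_add_atTop_iff_nat 1).mpr hp
    have := ((hp.neg.mul_const w).div (hp1.const_sub 1) (by simp)).norm
    simpa using this
  refine hlim.congr fun k => ?_
  rw [norm_norm, norm_norm, ← norm_div]
  congr 1
  rw [div_eq_div_iff (one_sub_pow_succ_ne_zero hq k) (hne k)]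
  linear_combination (-(w ^ k * w)) * phiCoeff_succ hq k

theorem summable_phiT_terms {q : ℂ} (hq0 : q ≠ 0) (hq : ‖q‖ < 1) {b : ℂ}
    (hb : ∀ k : ℕ, ‖qpInf q (b * q ^ k)‖ ≤ 1) (w : ℂ) :
    Summable fun k : ℕ => qpInf q (b * q ^ k) * (phiCoeff q k * w ^ k) := by
  refine Summable.of_norm_bounded (summable_norm_phiCoeff_mul_pow hq0 hq w) fun k => ?_
  rw [norm_mul]
  exact mul_le_of_le_one_left (norm_nonneg _) (hb k)

theorem phiT_three_term {q : ℂ} (hq0 : q ≠ 0) (hq : ‖q‖ < 1) {b : ℂ}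
    (hb : ∀ k : ℕ, ‖qpInf q (b * q ^ k)‖ ≤ 1) (w : ℂ) :
    phiT q b w - (1 - b - w) * phiT q (b * q) (w * q)
      + b * w * q * phiT q (b * q ^ 2) (w * q ^ 2) = 0 := by
  have hb' : ∀ n k : ℕ, ‖qpInf q (b * q ^ n * q ^ k)‖ ≤ 1 := fun n k => by
    rw [mul_assoc, ← pow_add]
    exact hb _
  have hX := summable_phiT_terms hq0 hq hb w
  have hY := summable_phiT_terms hq0 hq (b := b * q) (by simpa using hb' 1) (w * q)
  have hZ := summable_phiT_terms hq0 hq (hb' 2) (w * q ^ 2)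
  rw [phiT_eq_tsum, phiT_eq_tsum, phiT_eq_tsum]
  set X : ℕ → ℂ := fun k => qpInf q (b * q ^ k) * (phiCoeff q k * w ^ k) with hXd
  set Y : ℕ → ℂ := fun k => qpInf q (b * q * q ^ k) * (phiCoeff q k * (w * q) ^ k) with hYd
  set Z : ℕ → ℂ := fun k => qpInf q (b * q ^ 2 * q ^ k) * (phiCoeff q k * (w * q ^ 2) ^ k) with hZd
  have h0 : X 0 - (1 - b) * Y 0 = 0 := by
    simp only [hXd, hYd, pow_zero, mul_one]
    rw [qpInf_eq_mul hq b]
    ring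
  have hs : ∀ k, X (k + 1) - (1 - b) * Y (k + 1) + w * Y k + b * w * q * Z k = 0 := fun k => by
    have e1 : b * q * q ^ k = b * q ^ (k + 1) := by ring
    have e2 : b * q * q ^ (k + 1) = b * q ^ (k + 1) * q := by ring
    have e3 : b * q ^ 2 * q ^ k = b * q ^ (k + 1) * q := by ring
    simp only [hXd, hYd, hZd, e1, e2, e3]
    rw [qpInf_eq_mul hq (b * q ^ (k + 1))]
    linear_combination (qpInf q (b * q ^ (k + 1) * q) * w ^ (k + 1)) * phiCoeff_succ hq k
  have hsum : ∑' k, (X (k + 1) - (1 - b) * Y (k + 1) + w * Y k + b * w * q * Z k) = 0 := by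
    simp [hs]
  have hX1 := (summable_nat_add_iff 1).mpr hX
  have hY1 := (summable_nat_add_iff 1).mpr hY
  rw [(((hX1.sub (hY1.mul_left _)).add (hY.mul_left _))).tsum_add (hZ.mul_left _),
    (hX1.sub (hY1.mul_left _)).tsum_add (hY.mul_left _), hX1.tsum_sub (hY1.mul_left _),
    tsum_mul_left, tsum_mul_left, tsum_mul_left] at hsum
  have hX0 := hX.tsum_eq_zero_add
  have hY0 := hY.tsum_eq_zero_add
  linear_combination hsum + h0 + hX0 - (1 - b) * hY0

theorem phiT_zpow_one_sub {q : ℂ} (hq0 : q ≠ 0) (hq : ‖q‖ < 1) (n : ℕ) {w : ℂ}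
    (hb : ∀ i : ℤ, ‖qpInf q (q ^ i)‖ ≤ 1) :
    phiT q (q ^ (1 - n : ℤ)) w =
      (-1) ^ n * q ^ (n * (n - 1) / 2) * w ^ n * phiT q (q ^ (n + 1 : ℤ)) (w * q ^ n) := by
  have hb' : ∀ (i : ℤ) (k : ℕ), q ^ i * q ^ k = q ^ (i + k) := fun i k => by
    rw [zpow_add₀ hq0, zpow_natCast]
  have hs := summable_phiT_terms hq0 hq (b := q ^ (1 - n : ℤ))
    (fun k => by rw [hb']; exact hb _) w
  rw [phiT_eq_tsum, phiT_eq_tsum, ← hs.sum_add_tsum_nat_add n, Finset.sum_eq_zero, zero_add,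
    ← tsum_mul_left]
  · congr 1
    ext l
    have e1 : q ^ (1 - n : ℤ) * q ^ (l + n) = q ^ (l + 1) := by
      rw [hb', ← zpow_natCast]
      congr 1
      push_cast
      ring
    have e2 : q ^ (n + 1 : ℤ) * q ^ l = q ^ (l + n + 1) := by
      rw [hb', ← zpow_natCast]
      congr 1
      push_cast
      ring
    have e3 : (l + n) * (l + n - 1) / 2 = n * (n - 1) / 2 + l * (l - 1) / 2 + l * n := by
      rw [← Finset.sum_range_id_mul_two, ← Finset.sum_range_id_mul_two,
        ← Finset.sum_range_id_mul_two]
      simp only [Nat.mul_div_cancel _ zero_lt_two]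
      rw [add_comm l n, Finset.sum_range_add, Finset.sum_add_distrib]
      simp
      ring
    have h1 := qpInf_pow_succ_mul_qp hq l
    have h2 := qpInf_pow_succ_mul_qp hq (l + n)
    have h3 : qpInf q (q ^ (l + 1)) / qp q q (l + n) = qpInf q (q ^ (l + n + 1)) / qp q q l := by
      rw [div_eq_div_iff (qp_self_ne_zero hq _) (qp_self_ne_zero hq _), h1, h2]
    rw [e1, e2]
    unfold phiCoeff
    rw [e3]
    calc _ = (-1) ^ (l + n) * q ^ (n * (n - 1) / 2 + l * (l - 1) / 2 + l * n) * w ^ (l + n)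
          * (qpInf q (q ^ (l + 1)) / qp q q (l + n)) := by ring
      _ = _ := by
        rw [h3]
        ring
  · intro k hk
    rw [hb', qpInf_zpow_of_nonpos hq0, zero_mul]
    have := Finset.mem_range.mp hk
    omega

theorem norm_phiT_mul_pow_le {q : ℂ} (hq0 : q ≠ 0) (hq : ‖q‖ < 1) {b : ℂ}
    (hb : ∀ k : ℕ, ‖qpInf q (b * q ^ k)‖ ≤ 1) (w : ℂ) (n : ℕ) :
    ‖phiT q b (w * q ^ n)‖ ≤ ∑' k, ‖phiCoeff q k * w ^ k‖ := by
  rw [phiT_eq_tsum]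
  refine tsum_of_norm_bounded (summable_norm_phiCoeff_mul_pow hq0 hq w).hasSum fun k => ?_
  rw [norm_mul]
  refine (mul_le_of_le_one_left (norm_nonneg _) (hb k)).trans ?_
  rw [mul_pow, ← mul_assoc, norm_mul _ ((q ^ n) ^ k)]
  refine mul_le_of_le_one_right (norm_nonneg _) ?_
  rw [norm_pow, norm_pow]
  exact pow_le_one₀ (by positivity) (pow_le_one₀ (norm_nonneg _) hq.le)

theorem exists_phiT_ne_zero {q : ℂ} (hq0 : q ≠ 0) (hq : ‖q‖ < 1)
    (hb : ∀ i : ℤ, ‖qpInf q (q ^ i)‖ ≤ 1) (w : ℂ) :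
    ∃ n : ℕ, phiT q (q ^ (n + 1 : ℤ)) (w * q ^ n) ≠ 0 := by
  by_contra! hzero
  have hS := (summable_nat_add_iff 1).mpr (summable_norm_phiCoeff_mul_pow hq0 hq w)
  set C := ∑' k, ‖phiCoeff q (k + 1) * w ^ (k + 1)‖
  have hbn : ∀ n k : ℕ, ‖qpInf q (q ^ (n + 1 : ℤ) * q ^ k)‖ ≤ 1 := fun n k => by
    rw [← zpow_natCast, ← zpow_add₀ hq0]
    exact hb _
  have key : ∀ n : ℕ, ‖qpInf q q‖ ≤ ‖q‖ ^ n * C * ‖qp q q n‖ := fun n => by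
    have h := hzero n
    rw [phiT_eq_tsum, (summable_phiT_terms hq0 hq (hbn n) _).tsum_eq_zero_add] at h
    have hz : q ^ (n + 1 : ℤ) = q ^ (n + 1) := by rw [← zpow_natCast]; norm_cast
    have h1 : qpInf q (q ^ (n + 1)) = -∑' k : ℕ, qpInf q (q ^ (n + 1 : ℤ) * q ^ (k + 1)) *
        (phiCoeff q (k + 1) * (w * q ^ n) ^ (k + 1)) := by
      rw [eq_neg_iff_add_eq_zero]
      simpa [phiCoeff, qp, hz] using h
    rw [← qpInf_pow_succ_mul_qp hq n, norm_mul, h1, norm_neg]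
    refine mul_le_mul_of_nonneg_right ?_ (norm_nonneg _)
    refine tsum_of_norm_bounded (hS.hasSum.mul_left (‖q‖ ^ n)) fun k => ?_
    rw [norm_mul]
    refine (mul_le_of_le_one_left (norm_nonneg _) (hbn n _)).trans ?_
    rw [mul_pow, ← mul_assoc, norm_mul _ ((q ^ n) ^ (k + 1)), mul_comm]
    refine mul_le_mul_of_nonneg_right ?_ (norm_nonneg _)
    rw [norm_pow, norm_pow, pow_succ]
    exact mul_le_of_le_one_left (by positivity)
      (pow_le_one₀ (by positivity) (pow_le_one₀ (norm_nonneg _) hq.le))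
  have hqp : Tendsto (fun n => qp q q n) atTop (𝓝 (qpInf q q)) :=
    (multipliable_one_sub_mul_pow hq q).hasProd.tendsto_prod_nat
  have hlim := ((tendsto_pow_atTop_nhds_zero_of_lt_one (norm_nonneg q) hq).mul_const C).mul hqp.norm
  rw [zero_mul, zero_mul] at hlim
  exact qpInf_self_ne_zero hq (norm_le_zero_iff.mp (ge_of_tendsto' hlim key))

theorem Int.triangle_add (a b : ℤ) :
    (a + b) * (a + b + 1) / 2 = a * (a + 1) / 2 + b * (b + 1) / 2 + a * b := by
  obtain ⟨s, hs⟩ := Int.even_mul_succ_self a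
  obtain ⟨t, ht⟩ := Int.even_mul_succ_self b
  have h : (a + b) * (a + b + 1) = a * (a + 1) + b * (b + 1) + 2 * (a * b) := by ring
  rw [h, hs, ht]
  omega

theorem norm_vmj {q : ℝ} (hq0 : 0 < q) (α : ℝ) (m j : ℤ) :
    ‖vmj q α m j‖ = |α| ^ (-j) * q ^ (j * (j + 1) / 2) *
      ‖phiT (q : ℂ) ((q : ℂ) ^ (j - m + 1)) ((α : ℂ) ^ (-2 : ℤ) * (q : ℂ) ^ (m + j + 1))‖ := by
  simp [vmj, abs_of_pos hq0]

theorem norm_vmj_add_nat {q : ℝ} (hq0 : 0 < q) {α : ℝ} (hα : α ≠ 0) (m : ℤ) (n : ℕ) :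
    ‖vmj q α m (m + n)‖ =
      |α| ^ (-m) * q ^ (m * (m + 1) / 2) * (q ^ m / |α|) ^ n * q ^ ((n : ℤ) * (n + 1) / 2) *
      ‖phiT (q : ℂ) ((q : ℂ) ^ (n + 1 : ℤ))
        ((α : ℂ) ^ (-2 : ℤ) * (q : ℂ) ^ (2 * m + 1) * (q : ℂ) ^ n)‖ := by
  have hqc : (q : ℂ) ≠ 0 := by exact_mod_cast hq0.ne'
  have hα' : |α| ≠ 0 := abs_ne_zero.mpr hα
  have e : (α : ℂ) ^ (-2 : ℤ) * (q : ℂ) ^ (m + (m + n) + 1) =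
      (α : ℂ) ^ (-2 : ℤ) * (q : ℂ) ^ (2 * m + 1) * (q : ℂ) ^ n := by
    rw [mul_assoc, ← zpow_natCast, ← zpow_add₀ hqc]
    ring_nf
  rw [norm_vmj hq0, e, add_sub_cancel_left]
  congr 1
  rw [Int.triangle_add, zpow_add₀ hq0.ne', zpow_add₀ hq0.ne', neg_add, zpow_add₀ hα', div_pow,
    zpow_mul, zpow_neg, zpow_neg, zpow_natCast, zpow_natCast]
  field_simp

theorem norm_vmj_sub_nat {q : ℝ} (hq0 : 0 < q) (hq1 : q < 1) {α : ℝ} (hα : α ≠ 0) (m : ℤ)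
    (n : ℕ) :
    ‖vmj q α m (m - n)‖ =
      |α| ^ (-m) * q ^ (m * (m + 1) / 2) * (q ^ m / |α|) ^ n *
      ‖phiT (q : ℂ) ((q : ℂ) ^ (n + 1 : ℤ)) ((α : ℂ) ^ (-2 : ℤ) * (q : ℂ) ^ (2 * m + 1))‖ := by
  have hqc : (q : ℂ) ≠ 0 := by exact_mod_cast hq0.ne'
  have hq : ‖(q : ℂ)‖ < 1 := by simpa [abs_of_pos hq0] using hq1
  have hα' : |α| ≠ 0 := abs_ne_zero.mpr hα
  have e : (α : ℂ) ^ (-2 : ℤ) * (q : ℂ) ^ (m + (m - n) + 1) * (q : ℂ) ^ n =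
      (α : ℂ) ^ (-2 : ℤ) * (q : ℂ) ^ (2 * m + 1) := by
    rw [mul_assoc, ← zpow_natCast, ← zpow_add₀ hqc]
    ring_nf
  have ht : m * (m + 1) / 2 + -n * (-n + 1) / 2 + m * -n + ((n * (n - 1) / 2 : ℕ) : ℤ)
      + (m + (m - n) + 1) * n = m * (m + 1) / 2 + m * n := by
    have h2 : (((n * (n - 1) / 2 : ℕ) : ℤ)) * 2 = n * n - n := by
      rw [← Finset.sum_range_id]
      have := Finset.sum_range_id_mul_two n
      rcases n with _ | n
      · simp
      · zify at this ⊢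
        rw [this]
        simp
        ring
    have h : -(n : ℤ) * (-n + 1) / 2 = ((n * (n - 1) / 2 : ℕ) : ℤ) := by
      rw [show -(n : ℤ) * (-n + 1) = ((n * (n - 1) / 2 : ℕ) : ℤ) * 2 by linear_combination -h2,
        Int.mul_ediv_cancel _ two_ne_zero]
    rw [h]
    linear_combination h2
  rw [norm_vmj hq0, show m - n - m + 1 = (1 - n : ℤ) by ring,
    phiT_zpow_one_sub hqc hq n (norm_qpInf_zpow_le_one hq0 hq1), e, norm_mul, ← mul_assoc]
  congr 1
  have hn : ‖(-1 : ℂ) ^ n * (q : ℂ) ^ (n * (n - 1) / 2) *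
      ((α : ℂ) ^ (-2 : ℤ) * (q : ℂ) ^ (m + (m - n) + 1)) ^ n‖ =
      q ^ ((n * (n - 1) / 2 : ℕ) : ℤ) * ((|α| ^ 2)⁻¹ ^ n * q ^ ((m + (m - n) + 1) * n)) := by
    rw [zpow_mul, zpow_natCast, zpow_natCast, ← mul_pow]
    simp [abs_of_pos hq0, zpow_neg]
  rw [hn, show (m - n) * (m - n + 1) / 2 = m * (m + 1) / 2 + -n * (-n + 1) / 2 + m * -n by
    rw [sub_eq_add_neg, Int.triangle_add]]
  calc _ = |α| ^ (-(m - n : ℤ)) * (|α| ^ 2)⁻¹ ^ n *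
        q ^ (m * (m + 1) / 2 + -n * (-n + 1) / 2 + m * -n + ((n * (n - 1) / 2 : ℕ) : ℤ)
          + (m + (m - n) + 1) * n) := by
        rw [zpow_add₀ hq0.ne' (_ + ((n * (n - 1) / 2 : ℕ) : ℤ)),
          zpow_add₀ hq0.ne' _ ((n * (n - 1) / 2 : ℕ) : ℤ)]
        ring_nf
    _ = _ := by
        rw [ht, zpow_add₀ hq0.ne', zpow_mul, zpow_natCast, neg_sub, zpow_sub₀ hα',
          zpow_natCast, div_pow, inv_pow, zpow_neg]
        field_simp
        ring

theorem summable_norm_sq_vmj {q : ℝ} (hq0 : 0 < q) (hq1 : q < 1) {α : ℝ} (hα : α ≠ 0) {m : ℤ}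
    (hm : q ^ m < |α|) : Summable fun j : ℤ => ‖vmj q α m j‖ ^ 2 := by
  have hqc : (q : ℂ) ≠ 0 := by exact_mod_cast hq0.ne'
  have hq : ‖(q : ℂ)‖ < 1 := by simpa [abs_of_pos hq0] using hq1
  have hα' : 0 < |α| := abs_pos.mpr hα
  have hb : ∀ n k : ℕ, ‖qpInf (q : ℂ) ((q : ℂ) ^ (n + 1 : ℤ) * (q : ℂ) ^ k)‖ ≤ 1 := fun n k => by
    rw [← zpow_natCast, ← zpow_add₀ hqc]
    exact norm_qpInf_zpow_le_one hq0 hq1 _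
  set w : ℂ := (α : ℂ) ^ (-2 : ℤ) * (q : ℂ) ^ (2 * m + 1) with hw
  set r : ℝ := q ^ m / |α| with hr
  set A : ℝ := |α| ^ (-m) * q ^ (m * (m + 1) / 2) with hA
  set C : ℝ := ∑' k, ‖phiCoeff (q : ℂ) k * w ^ k‖
  have hr0 : 0 ≤ r := by positivity
  have hr1 : r < 1 := (div_lt_one hα').mpr hm
  have hA0 : 0 ≤ A := by positivity
  have hplus : ∀ n : ℕ, ‖vmj q α m (m + n)‖ ≤ A * C * r ^ n := fun n => by
    rw [norm_vmj_add_nat hq0 hα, ← hw, ← hr, ← hA]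
    have h1 : q ^ ((n : ℤ) * (n + 1) / 2) ≤ 1 := zpow_le_one₀ hq0 hq1.le (by positivity)
    have h2 := norm_phiT_mul_pow_le hqc hq (hb n) w n
    calc _ ≤ A * r ^ n * 1 * C := by gcongr
      _ = _ := by ring
  have hminus : ∀ n : ℕ, ‖vmj q α m (m - n)‖ ≤ A * C * r ^ n := fun n => by
    rw [norm_vmj_sub_nat hq0 hq1 hα, ← hw, ← hr, ← hA]
    have h2 := norm_phiT_mul_pow_le hqc hq (hb n) w 0
    rw [pow_zero, mul_one] at h2
    calc _ ≤ A * r ^ n * C := by gcongr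
      _ = _ := by ring
  have hgeom : Summable fun n : ℕ => (A * C * r ^ n) ^ 2 := by
    have := (summable_geometric_of_lt_one (sq_nonneg r)
      (pow_lt_one₀ hr0 hr1 two_ne_zero)).mul_left ((A * C) ^ 2)
    refine this.congr fun n => ?_
    ring
  rw [← (Equiv.addLeft m).summable_iff]
  refine Summable.of_nat_of_neg ?_ ?_
  · refine hgeom.of_nonneg_of_le (fun _ => sq_nonneg _) fun n => ?_
    exact pow_le_pow_left₀ (norm_nonneg _) (hplus n) 2
  · refine hgeom.of_nonneg_of_le (fun _ => sq_nonneg _) fun n => ?_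
    exact pow_le_pow_left₀ (norm_nonneg _) (hminus n) 2

theorem exists_vmj_ne_zero {q : ℝ} (hq0 : 0 < q) (hq1 : q < 1) {α : ℝ} (hα : α ≠ 0) (m : ℤ) :
    ∃ j : ℤ, vmj q α m j ≠ 0 := by
  have hqc : (q : ℂ) ≠ 0 := by exact_mod_cast hq0.ne'
  have hq : ‖(q : ℂ)‖ < 1 := by simpa [abs_of_pos hq0] using hq1
  have hα' : 0 < |α| := abs_pos.mpr hα
  obtain ⟨n, hn⟩ := exists_phiT_ne_zero hqc hq (norm_qpInf_zpow_le_one hq0 hq1)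
    ((α : ℂ) ^ (-2 : ℤ) * (q : ℂ) ^ (2 * m + 1))
  refine ⟨m + n, norm_ne_zero_iff.mp ?_⟩
  rw [norm_vmj_add_nat hq0 hα]
  have := norm_pos_iff.mpr hn
  positivity

theorem vmj_three_term {q : ℝ} (hq0 : 0 < q) (hq1 : q < 1) {α : ℝ} (hα : α ≠ 0) (m j : ℤ) :
    vmj q α m (j - 1) + (α : ℂ) * (q : ℂ) ^ (-j) * vmj q α m j + vmj q α m (j + 1)
      = ((α : ℂ)⁻¹ * (q : ℂ) ^ m + (α : ℂ) * (q : ℂ) ^ (-m)) * vmj q α m j := by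
  have hqc : (q : ℂ) ≠ 0 := by exact_mod_cast hq0.ne'
  have hαc : (α : ℂ) ≠ 0 := by exact_mod_cast hα
  have hq : ‖(q : ℂ)‖ < 1 := by simpa [abs_of_pos hq0] using hq1
  have hb : ∀ k : ℕ, ‖qpInf (q : ℂ) ((q : ℂ) ^ (j - m) * (q : ℂ) ^ k)‖ ≤ 1 := fun k => by
    rw [← zpow_natCast, ← zpow_add₀ hqc]
    exact norm_qpInf_zpow_le_one hq0 hq1 _
  have h := phiT_three_term hqc hq hb ((α : ℂ) ^ (-2 : ℤ) * (q : ℂ) ^ (m + j))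
  have e1 : (j - 1) * (j - 1 + 1) / 2 = j * (j + 1) / 2 - j := by
    rw [sub_eq_add_neg, Int.triangle_add]
    norm_num
    ring
  have e2 : (j + 1) * (j + 1 + 1) / 2 = j * (j + 1) / 2 + j + 1 := by
    rw [Int.triangle_add]
    norm_num
    ring
  have b0 : (q : ℂ) ^ (j - 1 - m + 1) = (q : ℂ) ^ (j - m) := by ring_nf
  have b1 : (q : ℂ) ^ (j - m + 1) = (q : ℂ) ^ (j - m) * q := zpow_add_one₀ hqc _
  have b2 : (q : ℂ) ^ (j + 1 - m + 1) = (q : ℂ) ^ (j - m) * (q : ℂ) ^ 2 := by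
    rw [← zpow_natCast, ← zpow_add₀ hqc]
    ring_nf
  have w0 : (q : ℂ) ^ (m + (j - 1) + 1) = (q : ℂ) ^ (m + j) := by ring_nf
  have w1 : (q : ℂ) ^ (m + j + 1) = (q : ℂ) ^ (m + j) * q := zpow_add_one₀ hqc _
  have w2 : (q : ℂ) ^ (m + (j + 1) + 1) = (q : ℂ) ^ (m + j) * (q : ℂ) ^ 2 := by
    rw [← zpow_natCast, ← zpow_add₀ hqc]
    ring_nf
  unfold vmj
  rw [e1, e2, b0, b1, b2, w0, w1, w2,
    ← mul_assoc ((α : ℂ) ^ (-2 : ℤ)) _ (q : ℂ), ← mul_assoc ((α : ℂ) ^ (-2 : ℤ)) _ ((q : ℂ) ^ 2)]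
  set P := phiT (q : ℂ) ((q : ℂ) ^ (j - m)) ((α : ℂ) ^ (-2 : ℤ) * (q : ℂ) ^ (m + j))
  set Q := phiT (q : ℂ) ((q : ℂ) ^ (j - m) * q) ((α : ℂ) ^ (-2 : ℤ) * (q : ℂ) ^ (m + j) * q)
  set R := phiT (q : ℂ) ((q : ℂ) ^ (j - m) * (q : ℂ) ^ 2)
    ((α : ℂ) ^ (-2 : ℤ) * (q : ℂ) ^ (m + j) * (q : ℂ) ^ 2)
  set T := j * (j + 1) / 2
  have hone : (-1 : ℂ) ≠ 0 := by norm_num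
  rw [zpow_sub₀ hqc j m, zpow_add₀ hqc m j, zpow_neg, zpow_ofNat] at h
  rw [zpow_sub_one₀ hone, zpow_add_one₀ hone, zpow_sub₀ hqc T, zpow_add_one₀ hqc, zpow_add₀ hqc T,
    zpow_neg, zpow_neg, zpow_neg, zpow_neg, zpow_neg, zpow_sub_one₀ hαc, zpow_add_one₀ hαc]
  have hqj : (q : ℂ) ^ j ≠ 0 := zpow_ne_zero _ hqc
  have hqm : (q : ℂ) ^ m ≠ 0 := zpow_ne_zero _ hqc
  have hαj : (α : ℂ) ^ j ≠ 0 := zpow_ne_zero _ hαc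
  generalize (q : ℂ) ^ j = x at *
  generalize (q : ℂ) ^ m = y at *
  generalize (α : ℂ) ^ j = z at *
  generalize (q : ℂ) ^ T = t at *
  generalize (-1 : ℂ) ^ j = s at *
  linear_combination (norm := skip) (-(α : ℂ) * x⁻¹ * s * z⁻¹ * t) * h
  field_simp
  ring

theorem stmt_16 (q : ℝ) (hq0 : 0 < q) (hq1 : q < 1) (α : ℝ) (hα : α ≠ 0) (m : ℤ)
    (hm : q ^ m < |α|) :
    (∃ j : ℤ, vmj q α m j ≠ 0) ∧
    Summable (fun j : ℤ => ‖vmj q α m j‖ ^ 2) ∧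
    (∀ j : ℤ, vmj q α m (j - 1) + (α : ℂ) * (q : ℂ) ^ (-j) * vmj q α m j + vmj q α m (j + 1)
      = ((α : ℂ)⁻¹ * (q : ℂ) ^ m + (α : ℂ) * (q : ℂ) ^ (-m)) * vmj q α m j) := by
  exact ⟨exists_vmj_ne_zero hq0 hq1 hα m, summable_norm_sq_vmj hq0 hq1 hα hm,
    vmj_three_term hq0 hq1 hα m⟩
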